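/- arXiv:2512.21785 — 4 statements merged into one kernel-verified Lean document; each statement's English description precedes it below -/
import Mathlib

section
/- For every m = (m₂,m₃,m₄,m₅) ∈ ℕ⁴, the product (V_m − 1)! · m₂! · m₃! · m₄! · m₅! divides (E_m − 1)!; equivalently, the hyper-Catalan number C_m = (E_m − 1)! / ((V_m − 1)! · m₂!·m₃!·m₄!·m₅!) is a natural number. -/
/-- E_m = 1 + 2m₂ + 3m₃ + 4m₄ + 5m₅, the number of edges. -/
def Em (m2 m3 m4 m5 : ℕ) : ℕ := 1 + 2 * m2 + 3 * m3 + 4 * m4 + 5 * m5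

/-- V_m = 2 + m₂ + 2m₃ + 3m₄ + 4m₅, the number of vertices. -/
def Vm (m2 m3 m4 m5 : ℕ) : ℕ := 2 + m2 + 2 * m3 + 3 * m4 + 4 * m5

/-- The hyper-Catalan number C_m = (E_m − 1)! / ((V_m − 1)! · m₂!·m₃!·m₄!·m₅!), as a rational. -/
def hyperCatalan (m2 m3 m4 m5 : ℕ) : ℚ :=
  (Nat.factorial (Em m2 m3 m4 m5 - 1) : ℚ) /
    ((Nat.factorial (Vm m2 m3 m4 m5 - 1) : ℚ) * (Nat.factorial m2) * (Nat.factorial m3) *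
      (Nat.factorial m4) * (Nat.factorial m5))

open Nat in
/-- The product of five factorials divides the factorial of the sum. -/
lemma prod_five_factorial_dvd_factorial_add (a b c d e : ℕ) :
    a ! * b ! * c ! * d ! * e ! ∣ (a + b + c + d + e)! :=
  (mul_dvd_mul_right ((mul_dvd_mul_right ((mul_dvd_mul_right
    (factorial_mul_factorial_dvd_factorial_add a b) _).trans
    (factorial_mul_factorial_dvd_factorial_add _ c)) _).trans
    (factorial_mul_factorial_dvd_factorial_add _ d)) _).trans
    (factorial_mul_factorial_dvd_factorial_add _ e)

open Nat in
/-- If five numbers sum to `n + 1`, the product of their factorials divides `n !` times any one of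
them. -/
lemma prod_five_factorial_dvd_mul_factorial {a b c d e n : ℕ} (h : a + b + c + d + e = n + 1) :
    a ! * b ! * c ! * d ! * e ! ∣ a * n ! := by
  cases a with
  | zero => simp
  | succ a =>
    obtain rfl : n = a + b + c + d + e := by omega
    simpa only [factorial_succ, mul_assoc] using
      mul_dvd_mul_left (a + 1) (prod_five_factorial_dvd_factorial_add a b c d e)

open Nat in
/-- Divisibility form of the integrality of the hyper-Catalan numbers. -/
lemma hyperCatalan_denom_dvd (a b c d : ℕ) :
    (1 + a + 2 * b + 3 * c + 4 * d)! * a ! * b ! * c ! * d ! ∣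
      (2 * a + 3 * b + 4 * c + 5 * d)! := by
  set k := 1 + a + 2 * b + 3 * c + 4 * d with hk
  set n := 2 * a + 3 * b + 4 * c + 5 * d with hn
  have h₀ : k ! * a ! * b ! * c ! * d ! ∣ k * n ! :=
    prod_five_factorial_dvd_mul_factorial (by omega)
  have h₁ : k ! * a ! * b ! * c ! * d ! ∣ a * n ! := by
    convert prod_five_factorial_dvd_mul_factorial
      (show a + k + b + c + d = n + 1 by omega) using 1
    ring
  have h₂ : k ! * a ! * b ! * c ! * d ! ∣ b * n ! := by
    convert prod_five_factorial_dvd_mul_factorial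
      (show b + k + a + c + d = n + 1 by omega) using 1
    ring
  have h₃ : k ! * a ! * b ! * c ! * d ! ∣ c * n ! := by
    convert prod_five_factorial_dvd_mul_factorial
      (show c + k + a + b + d = n + 1 by omega) using 1
    ring
  have h₄ : k ! * a ! * b ! * c ! * d ! ∣ d * n ! := by
    convert prod_five_factorial_dvd_mul_factorial
      (show d + k + a + b + c = n + 1 by omega) using 1
    ring
  have h₅ := ((h₁.add (h₂.mul_left 2)).add (h₃.mul_left 3)).add (h₄.mul_left 4)
  refine (Nat.dvd_add_right h₅).mp ?_
  convert h₀ using 1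
  rw [hk]
  ring

/-- For every m ∈ ℕ⁴, (V_m − 1)! · m₂!·m₃!·m₄!·m₅! divides (E_m − 1)!;
equivalently, the hyper-Catalan number C_m is a natural number. -/
theorem hyperCatalan_is_nat (m2 m3 m4 m5 : ℕ) :
    (Nat.factorial (Vm m2 m3 m4 m5 - 1) * Nat.factorial m2 * Nat.factorial m3 *
        Nat.factorial m4 * Nat.factorial m5) ∣ Nat.factorial (Em m2 m3 m4 m5 - 1) ∧
    ∃ c : ℕ, hyperCatalan m2 m3 m4 m5 = (c : ℚ) := by
  have h : (Nat.factorial (Vm m2 m3 m4 m5 - 1) * Nat.factorial m2 * Nat.factorial m3 *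
      Nat.factorial m4 * Nat.factorial m5) ∣ Nat.factorial (Em m2 m3 m4 m5 - 1) := by
    have hV : Vm m2 m3 m4 m5 - 1 = 1 + m2 + 2 * m3 + 3 * m4 + 4 * m5 := by
      unfold Vm; omega
    have hE : Em m2 m3 m4 m5 - 1 = 2 * m2 + 3 * m3 + 4 * m4 + 5 * m5 := by
      unfold Em; omega
    rw [hV, hE]
    exact hyperCatalan_denom_dvd m2 m3 m4 m5
  obtain ⟨c, hc⟩ := h
  refine ⟨⟨c, hc⟩, c, ?_⟩
  rw [hyperCatalan, hc]
  push_cast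
  exact mul_div_cancel_left₀ _ (by positivity)
end

section
/- The hyper-Catalan generating series S is a formal power series zero of the general geometric quintic polynomial: 1 − S + t₂·S² + t₃·S³ + t₄·S⁴ + t₅·S⁵ = 0 in the ring of multivariate formal power series over ℚ in the variables t₂,t₃,t₄,t₅. -/
/-- The exponent vector (m₂, m₃, m₄, m₅) as a finitely supported function on `Fin 4`. -/
noncomputable def idx (m2 m3 m4 m5 : ℕ) : Fin 4 →₀ ℕ := Finsupp.equivFunOnFinite.symm ![m2, m3, m4, m5]

/-- The hyper-Catalan generating series S = Σ_m C_m t₂^{m₂} t₃^{m₃} t₄^{m₄} t₅^{m₅},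
as a multivariate formal power series over ℚ in four variables
(variable `i : Fin 4` is t_{i+2}); its coefficient at exponent `m` is `C_m`. -/
def S : MvPowerSeries (Fin 4) ℚ := fun m => hyperCatalan (m 0) (m 1) (m 2) (m 3)

/-- The coefficient of `t ^ m` in the `r`-th power of the solution of `T = 1 + ∑ i, t i * T ^ (w i + 1)`. -/
def raneyCoeff {σ : Type*} [Fintype σ] (w : σ → ℕ) : ℕ → (σ →₀ ℕ) → ℚ
  | 0, m => if ∑ i, m i = 0 then 1 else 0
  | r + 1, m => (r + 1) * (Nat.factorial (∑ i, (w i + 1) * m i + r)) /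
      (Nat.factorial (∑ i, w i * m i + r + 1) * ∏ i, (Nat.factorial (m i) : ℚ))

/-- The generating series of `raneyCoeff w r`. -/
def raneySeries {σ : Type*} [Fintype σ] (w : σ → ℕ) (r : ℕ) : MvPowerSeries σ ℚ :=
  raneyCoeff w r

theorem MvPowerSeries.coeff_X_mul_eq_ite {σ R : Type*} [CommSemiring R] (i : σ)
    (m : σ →₀ ℕ) (f : MvPowerSeries σ R) : MvPowerSeries.coeff m (MvPowerSeries.X i * f) =
      if Finsupp.single i 1 ≤ m then MvPowerSeries.coeff (m - Finsupp.single i 1) f else 0 := by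
  classical
  rw [MvPowerSeries.X, MvPowerSeries.coeff_monomial_mul]
  simp

section Raney

variable {σ : Type*} [Fintype σ] (w : σ → ℕ)

theorem coeff_raneySeries (r : ℕ) (m : σ →₀ ℕ) :
    MvPowerSeries.coeff m (raneySeries w r) = raneyCoeff w r m := rfl

theorem sum_mul_add_single (v : σ → ℕ) (n : σ →₀ ℕ) (i : σ) :
    ∑ j, v j * (n + Finsupp.single i 1 : σ →₀ ℕ) j = ∑ j, v j * n j + v i := by
  classical
  simp [mul_add, Finset.sum_add_distrib, Finsupp.single_apply]

theorem prod_factorial_add_single (n : σ →₀ ℕ) (i : σ) :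
    ∏ j, (Nat.factorial ((n + Finsupp.single i 1 : σ →₀ ℕ) j) : ℚ) =
      (n i + 1) * ∏ j, (Nat.factorial (n j) : ℚ) := by
  classical
  rw [← Finset.mul_prod_erase _ _ (Finset.mem_univ i),
    ← Finset.mul_prod_erase _ (fun j => (Nat.factorial (n j) : ℚ)) (Finset.mem_univ i)]
  have h : ∏ j ∈ Finset.univ.erase i, (Nat.factorial ((n + Finsupp.single i 1 : σ →₀ ℕ) j) : ℚ) =
      ∏ j ∈ Finset.univ.erase i, (Nat.factorial (n j) : ℚ) :=
    Finset.prod_congr rfl fun j hj => by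
      simp [Finsupp.single_eq_of_ne (Finset.ne_of_mem_erase hj)]
  rw [h]
  simp [Nat.factorial_succ, mul_assoc]

theorem coeff_X_mul_raneySeries (r : ℕ) (i : σ) (m : σ →₀ ℕ) :
    MvPowerSeries.coeff m (MvPowerSeries.X i * raneySeries w (r + (w i + 1))) =
      m i * (r + w i + 1) * (Nat.factorial (∑ j, (w j + 1) * m j + r - 1)) /
      (Nat.factorial (∑ j, w j * m j + r + 1) * ∏ j, (Nat.factorial (m j) : ℚ)) := by
  rw [MvPowerSeries.coeff_X_mul_eq_ite]
  split_ifs with h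
  · obtain ⟨n, rfl⟩ := exists_add_of_le h
    rw [add_tsub_cancel_left, add_comm (Finsupp.single i 1) n, coeff_raneySeries, ← add_assoc,
      raneyCoeff, sum_mul_add_single w, sum_mul_add_single (fun j => w j + 1),
      prod_factorial_add_single]
    have hD : ∏ j, (Nat.factorial (n j) : ℚ) ≠ 0 :=
      Finset.prod_ne_zero_iff.2 fun j _ => by positivity
    have hn : (n i : ℚ) + 1 ≠ 0 := by positivity
    rw [show ∑ j, (w j + 1) * n j + (w i + 1) + r - 1 = ∑ j, (w j + 1) * n j + (r + w i) by omega,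
      show ∑ j, w j * n j + w i + r + 1 = ∑ j, w j * n j + (r + w i) + 1 by omega]
    simp only [Finsupp.add_apply, Finsupp.single_eq_same]
    push_cast
    field_simp
  · have : m i = 0 := by
      by_contra h0
      exact h (Finsupp.single_le_iff.2 (Nat.one_le_iff_ne_zero.2 h0))
    simp [this]

theorem raneySeries_zero : raneySeries w 0 = 1 := by
  classical
  ext m
  rw [coeff_raneySeries, MvPowerSeries.coeff_one, raneyCoeff]
  simp [Finsupp.ext_iff]

theorem raneySeries_succ (r : ℕ) : raneySeries w (r + 1) =
    raneySeries w r + ∑ i, MvPowerSeries.X i * raneySeries w (r + (w i + 1)) := by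
  ext m
  rw [map_add, map_sum]
  simp_rw [coeff_X_mul_raneySeries, coeff_raneySeries]
  rw [← Finset.sum_div, ← Finset.sum_mul]
  have hN : ∑ j, (w j + 1) * m j = ∑ j, w j * m j + ∑ j, m j := by
    simp [add_mul, Finset.sum_add_distrib]
  have hsum : ∑ i, (m i : ℚ) * (r + w i + 1) =
      r * (∑ j, m j : ℕ) + (∑ j, (w j + 1) * m j : ℕ) := by
    push_cast
    rw [Finset.mul_sum, ← Finset.sum_add_distrib]
    exact Finset.sum_congr rfl fun i _ => by ring
  have hD : ∏ j, (Nat.factorial (m j) : ℚ) ≠ 0 :=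
    Finset.prod_ne_zero_iff.2 fun j _ => by positivity
  rw [hsum]
  rcases Nat.eq_zero_or_pos (∑ j, m j) with h | h
  · have hm : m = 0 := by ext j; simpa using (Finset.sum_eq_zero_iff.1 h) j (Finset.mem_univ j)
    subst hm
    cases r with
    | zero => simp [raneyCoeff]
    | succ q =>
      simp [raneyCoeff, Nat.factorial_succ]
      field_simp
  · obtain ⟨p, hp⟩ : ∃ p, ∑ j, m j = p + 1 := ⟨_, (Nat.succ_pred_eq_of_pos h).symm⟩
    cases r with
    | zero =>
      simp only [raneyCoeff, hN, hp]
      generalize ∑ j, w j * m j = A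
      rw [if_neg p.succ_ne_zero, show A + (p + 1) + 0 - 1 = A + p by omega,
        show A + (p + 1) + 0 = A + p + 1 by omega, Nat.factorial_succ (A + p)]
      push_cast
      ring
    | succ q =>
      simp only [raneyCoeff, hN, hp]
      generalize ∏ j, (Nat.factorial (m j) : ℚ) = D at *
      generalize ∑ j, w j * m j = A
      rw [show A + (p + 1) + (q + 1) - 1 = A + (p + 1) + q by omega,
        show A + (p + 1) + (q + 1) = A + (p + 1) + q + 1 by omega,
        Nat.factorial_succ (A + (p + 1) + q), ← add_assoc A q 1, Nat.factorial_succ (A + q + 1)]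
      push_cast
      field_simp
      ring

theorem eq_zero_of_raney_recurrence (G : ℕ → MvPowerSeries σ ℚ) (h0 : G 0 = 0)
    (hG : ∀ r, G (r + 1) = G r + ∑ i, MvPowerSeries.X i * G (r + (w i + 1))) (r : ℕ) :
    G r = 0 := by
  suffices h : ∀ d r (m : σ →₀ ℕ), m.degree = d → MvPowerSeries.coeff m (G r) = 0 from
    MvPowerSeries.ext fun m => by simpa using h _ r m rfl
  intro d
  induction d using Nat.strong_induction_on with
  | _ d ih =>
    intro r m hm
    induction r with
    | zero => simp [h0]
    | succ r ihr =>
      rw [hG, map_add, map_sum, ihr, zero_add]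
      refine Finset.sum_eq_zero fun i _ => ?_
      rw [MvPowerSeries.coeff_X_mul_eq_ite]
      split_ifs with h
      · obtain ⟨n, rfl⟩ := exists_add_of_le h
        rw [add_tsub_cancel_left]
        refine ih n.degree ?_ _ _ rfl
        rw [← hm, map_add, Finsupp.degree_single]
        omega
      · rfl

theorem raneySeries_mul (r s : ℕ) :
    raneySeries w r * raneySeries w s = raneySeries w (r + s) := by
  refine sub_eq_zero.1 (eq_zero_of_raney_recurrence w
    (fun r => raneySeries w r * raneySeries w s - raneySeries w (r + s)) ?_ (fun r => ?_) r)
  · simp [raneySeries_zero]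
  · have h (k : ℕ) : r + k + s = r + s + k := add_right_comm r k s
    simp only [h, raneySeries_succ w r, raneySeries_succ w (r + s), add_mul, Finset.sum_mul,
      mul_sub, Finset.sum_sub_distrib, mul_assoc]
    ring

theorem raneySeries_one_pow (r : ℕ) : raneySeries w 1 ^ r = raneySeries w r := by
  induction r with
  | zero => rw [pow_zero, raneySeries_zero]
  | succ r ih => rw [pow_succ, ih, raneySeries_mul]

theorem raneySeries_one_eq : raneySeries w 1 =
    1 + ∑ i, MvPowerSeries.X i * raneySeries w 1 ^ (w i + 1) := by
  simpa [raneySeries_one_pow, raneySeries_zero] using raneySeries_succ w 0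

end Raney

theorem S_eq_raneySeries : S = raneySeries (fun i : Fin 4 => (i : ℕ) + 1) 1 := by
  ext m
  change hyperCatalan (m 0) (m 1) (m 2) (m 3) = raneyCoeff _ (0 + 1) m
  simp only [hyperCatalan, raneyCoeff, Em, Vm, Fin.sum_univ_four, Fin.prod_univ_four]
  norm_num [mul_assoc]
  congr 4 <;> omega

/-- The hyper-Catalan generating series S is a formal power series zero of the
general geometric quintic: 1 − S + t₂S² + t₃S³ + t₄S⁴ + t₅S⁵ = 0. -/
theorem geometric_quintic_formula :
    1 - S + MvPowerSeries.X (0 : Fin 4) * S ^ 2 + MvPowerSeries.X (1 : Fin 4) * S ^ 3 +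
      MvPowerSeries.X (2 : Fin 4) * S ^ 4 + MvPowerSeries.X (3 : Fin 4) * S ^ 5 = 0 := by
  have h := raneySeries_one_eq (fun i : Fin 4 => (i : ℕ) + 1)
  rw [← S_eq_raneySeries, Fin.sum_univ_four] at h
  norm_num at h
  linear_combination -h
end

section
/- There exists a unique multivariate formal power series G over ℚ in the variables t₂,t₃,t₄,t₅ such that S − 1 = (t₂ + t₃ + t₄ + t₅) · G. -/
open MvPowerSeries in
/-- The coefficient of a monomial in `X i * f`. -/
theorem coeff_add_single_X_mul {σ R : Type*} [CommSemiring R] (i : σ) (m : σ →₀ ℕ)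
    (f : MvPowerSeries σ R) :
    coeff (m + Finsupp.single i 1) (X i * f) = coeff m f := by
  rw [add_comm, X, coeff_add_monomial_mul, one_mul]

open MvPowerSeries in
theorem coeff_X_mul_of_eq_zero {σ R : Type*} [CommSemiring R] (i : σ) (m : σ →₀ ℕ)
    (f : MvPowerSeries σ R) (h : m i = 0) :
    coeff m (X i * f) = 0 := by
  classical
  rw [X, coeff_monomial_mul, if_neg]
  simp [h]

/-- The number `e m = ∑ k m_k`, where the index `i : Fin 4` stands for `k = i + 2`. -/
def edgeWeight (m : Fin 4 →₀ ℕ) : ℕ := ∑ i : Fin 4, ((i : ℕ) + 2) * m i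

/-- The number `∑ (k - 1) m_k`, where the index `i : Fin 4` stands for `k = i + 2`. -/
def vertexWeight (m : Fin 4 →₀ ℕ) : ℕ := ∑ i : Fin 4, ((i : ℕ) + 1) * m i

/-- The product of the factorials of the exponents. -/
def factorialProd (m : Fin 4 →₀ ℕ) : ℚ := ∏ i, (Nat.factorial (m i) : ℚ)

theorem factorialProd_ne_zero (m : Fin 4 →₀ ℕ) : factorialProd m ≠ 0 :=
  Finset.prod_ne_zero_iff.mpr fun i _ => by positivity

theorem edgeWeight_add_single (m : Fin 4 →₀ ℕ) (i : Fin 4) :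
    edgeWeight (m + Finsupp.single i 1) = edgeWeight m + (i + 2) := by
  simp [edgeWeight, mul_add, Finset.sum_add_distrib, Finsupp.single_apply]

theorem vertexWeight_add_single (m : Fin 4 →₀ ℕ) (i : Fin 4) :
    vertexWeight (m + Finsupp.single i 1) = vertexWeight m + (i + 1) := by
  simp [vertexWeight, mul_add, Finset.sum_add_distrib, Finsupp.single_apply]

theorem factorialProd_add_single (m : Fin 4 →₀ ℕ) (i : Fin 4) :
    factorialProd (m + Finsupp.single i 1) = (m i + 1) * factorialProd m := by
  fin_cases i <;>
    simp [factorialProd, Fin.prod_univ_four, Nat.factorial_succ] <;> ring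

theorem edgeWeight_pos {m : Fin 4 →₀ ℕ} (hm : m ≠ 0) : 0 < edgeWeight m := by
  obtain ⟨i, hi⟩ := Finsupp.ne_iff.mp hm
  refine Finset.sum_pos' (fun _ _ => Nat.zero_le _) ⟨i, Finset.mem_univ i, ?_⟩
  exact Nat.mul_pos (by omega) (Nat.pos_of_ne_zero hi)

theorem vertexWeight_add_sum (m : Fin 4 →₀ ℕ) : vertexWeight m + ∑ i, m i = edgeWeight m := by
  simp only [vertexWeight, edgeWeight, Fin.sum_univ_four]
  ring

/-- The closed form of the powers of the hyper-Catalan series, see `hyperCatalanPow_eq_pow`. -/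
noncomputable def hyperCatalanPow : ℕ → MvPowerSeries (Fin 4) ℚ
  | 0 => 1
  | r + 1 => fun m => (r + 1) * (Nat.factorial (edgeWeight m + r) : ℚ) /
      ((Nat.factorial (vertexWeight m + r + 1) : ℚ) * factorialProd m)

theorem coeff_hyperCatalanPow_succ (r : ℕ) (m : Fin 4 →₀ ℕ) :
    MvPowerSeries.coeff m (hyperCatalanPow (r + 1)) =
      (r + 1) * (Nat.factorial (edgeWeight m + r) : ℚ) /
        ((Nat.factorial (vertexWeight m + r + 1) : ℚ) * factorialProd m) := rfl

theorem coeff_zero_hyperCatalanPow (r : ℕ) :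
    MvPowerSeries.coeff 0 (hyperCatalanPow r) = 1 := by
  cases r with
  | zero => simp [hyperCatalanPow]
  | succ r =>
    rw [coeff_hyperCatalanPow_succ]
    have h : ((r : ℚ) + 1) * (Nat.factorial r : ℚ) ≠ 0 := by positivity
    simpa [edgeWeight, vertexWeight, factorialProd, Nat.factorial_succ] using div_self h

theorem hyperCatalanPow_one : hyperCatalanPow 1 = S := by
  ext m
  rw [coeff_hyperCatalanPow_succ 0]
  change _ = hyperCatalan (m 0) (m 1) (m 2) (m 3)
  have he : Em (m 0) (m 1) (m 2) (m 3) - 1 = edgeWeight m + 0 := by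
    simp [Em, edgeWeight, Fin.sum_univ_four]; omega
  have hv : Vm (m 0) (m 1) (m 2) (m 3) - 1 = vertexWeight m + 0 + 1 := by
    simp [Vm, vertexWeight, Fin.sum_univ_four]; omega
  rw [hyperCatalan, he, hv, factorialProd, Fin.prod_univ_four]
  simp [mul_assoc]

theorem coeff_X_mul_hyperCatalanPow (r N : ℕ) (m : Fin 4 →₀ ℕ) (i : Fin 4)
    (hN : edgeWeight m + r = N + 1) :
    MvPowerSeries.coeff m (MvPowerSeries.X i * hyperCatalanPow (r + (i + 2))) =
      m i * (r + (i + 2)) * (Nat.factorial N : ℚ) /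
        ((Nat.factorial (vertexWeight m + r + 1) : ℚ) * factorialProd m) := by
  by_cases h : m i = 0
  · simp [coeff_X_mul_of_eq_zero i m _ h, h]
  · obtain ⟨m, rfl⟩ : ∃ m', m = m' + Finsupp.single i 1 :=
      ⟨m - Finsupp.single i 1, (tsub_add_cancel_of_le (by simp; omega)).symm⟩
    rw [edgeWeight_add_single] at hN
    rw [coeff_add_single_X_mul, ← add_assoc r, coeff_hyperCatalanPow_succ,
      vertexWeight_add_single, factorialProd_add_single,
      show edgeWeight m + (r + i + 1) = N by omega,
      show vertexWeight m + (r + i + 1) + 1 = vertexWeight m + (i + 1) + r + 1 by omega]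
    have := factorialProd_ne_zero m
    simp
    field_simp
    ring

theorem hyperCatalanPow_succ (r : ℕ) :
    hyperCatalanPow (r + 1) = hyperCatalanPow r +
      ∑ i : Fin 4, MvPowerSeries.X i * hyperCatalanPow (r + (i + 2)) := by
  ext m
  rw [map_add, map_sum]
  by_cases hm : m = 0
  · subst hm
    rw [Finset.sum_eq_zero fun i _ => coeff_X_mul_of_eq_zero i 0 _ rfl]
    simp only [coeff_zero_hyperCatalanPow, add_zero]
  have hpos := edgeWeight_pos hm
  obtain ⟨N, hN⟩ : ∃ N, edgeWeight m + r = N + 1 := ⟨edgeWeight m + r - 1, by omega⟩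
  rw [Finset.sum_congr rfl fun i _ => coeff_X_mul_hyperCatalanPow r N m i hN,
    ← Finset.sum_div, ← Finset.sum_mul, coeff_hyperCatalanPow_succ]
  have hsum : ∑ i : Fin 4, (m i : ℚ) * (r + (i + 2)) = r * ∑ i, (m i : ℚ) + edgeWeight m := by
    simp only [edgeWeight, Fin.sum_univ_four]
    push_cast
    ring
  have hv : (vertexWeight m : ℚ) + ∑ i, (m i : ℚ) = edgeWeight m := by
    exact_mod_cast vertexWeight_add_sum m
  have hN' : (edgeWeight m : ℚ) + r = N + 1 := by exact_mod_cast hN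
  have hP := factorialProd_ne_zero m
  rw [hsum, hN]
  cases r with
  | zero =>
    rw [hyperCatalanPow, MvPowerSeries.coeff_one, if_neg hm, Nat.factorial_succ]
    have : (edgeWeight m : ℚ) = N + 1 := by simpa using hN'
    rw [this]
    push_cast
    ring
  | succ r =>
    rw [coeff_hyperCatalanPow_succ, show edgeWeight m + r = N by omega,
      Nat.factorial_succ (vertexWeight m + (r + 1)), Nat.factorial_succ N, ← add_assoc]
    push_cast at hN' ⊢
    have h1 : (vertexWeight m : ℚ) + r + 1 + 1 ≠ 0 := by positivity
    field_simp
    have h2 : (N : ℚ) = edgeWeight m + r := by linarith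
    rw [h2, ← hv]
    ring

/-- A sequence of power series with zero initial term satisfying the recursion of the powers of
the hyper-Catalan series vanishes. -/
theorem eq_zero_of_recursion (D : ℕ → MvPowerSeries (Fin 4) ℚ) (h0 : D 0 = 0)
    (hD : ∀ r, D (r + 1) = D r + ∑ i : Fin 4, MvPowerSeries.X i * D (r + (i + 2))) (r : ℕ) :
    D r = 0 := by
  suffices ∀ n (m : Fin 4 →₀ ℕ), m.degree = n → ∀ r, MvPowerSeries.coeff m (D r) = 0 by
    ext m
    simpa using this _ m rfl r
  intro n
  induction n with
  | zero =>
    intro m hm r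
    obtain rfl : m = 0 := (Finsupp.degree_eq_zero_iff m).mp hm
    induction r with
    | zero => simp [h0]
    | succ r ih =>
      rw [hD, map_add, map_sum, ih,
        Finset.sum_eq_zero fun i _ => coeff_X_mul_of_eq_zero i 0 _ rfl, add_zero]
  | succ n ihn =>
    intro m hm r
    induction r with
    | zero => simp [h0]
    | succ r ih =>
      rw [hD, map_add, map_sum, ih, zero_add]
      refine Finset.sum_eq_zero fun i _ => ?_
      by_cases h : m i = 0
      · exact coeff_X_mul_of_eq_zero i m _ h
      · obtain ⟨m, rfl⟩ : ∃ m', m = m' + Finsupp.single i 1 :=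
          ⟨m - Finsupp.single i 1, (tsub_add_cancel_of_le (by simp; omega)).symm⟩
        rw [coeff_add_single_X_mul]
        exact ihn m (by simpa using hm) _

theorem hyperCatalanPow_mul (r s : ℕ) :
    hyperCatalanPow r * hyperCatalanPow s = hyperCatalanPow (r + s) := by
  rw [← sub_eq_zero]
  refine eq_zero_of_recursion
    (fun r => hyperCatalanPow r * hyperCatalanPow s - hyperCatalanPow (r + s)) ?_ ?_ r
  · simp [hyperCatalanPow]
  · intro r
    simp only [mul_sub, Finset.sum_sub_distrib]
    rw [add_right_comm r 1 s, hyperCatalanPow_succ (r + s), hyperCatalanPow_succ r, add_mul,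
      Finset.sum_mul]
    simp only [mul_assoc, add_right_comm r _ s]
    ring

theorem hyperCatalanPow_eq_pow (r : ℕ) : hyperCatalanPow r = S ^ r := by
  induction r with
  | zero => rfl
  | succ r ih => rw [← hyperCatalanPow_mul, ih, hyperCatalanPow_one, pow_succ]

/-- The functional equation of the hyper-Catalan series. -/
theorem S_eq : S = 1 + ∑ i : Fin 4, (MvPowerSeries.X i : MvPowerSeries (Fin 4) ℚ) * S ^ ((i : ℕ) + 2) := by
  simpa [hyperCatalanPow_eq_pow] using hyperCatalanPow_succ 0

/-- The Geode factorization: there is a unique formal power series G with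
S − 1 = (t₂ + t₃ + t₄ + t₅)·G. -/
theorem geode_factorization :
    ∃! G : MvPowerSeries (Fin 4) ℚ,
      S - 1 = (MvPowerSeries.X (0 : Fin 4) + MvPowerSeries.X (1 : Fin 4) +
        MvPowerSeries.X (2 : Fin 4) + MvPowerSeries.X (3 : Fin 4)) * G := by
  set L : MvPowerSeries (Fin 4) ℚ := MvPowerSeries.X (0 : Fin 4) + MvPowerSeries.X (1 : Fin 4) +
    MvPowerSeries.X (2 : Fin 4) + MvPowerSeries.X (3 : Fin 4) with hL
  have hL0 : L ≠ 0 := fun h => by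
    have := congrArg (MvPowerSeries.coeff (Finsupp.single (0 : Fin 4) 1)) h
    simp [hL, MvPowerSeries.coeff_X, Finsupp.single_left_inj] at this
  set H : MvPowerSeries (Fin 4) ℚ :=
    ∑ i : Fin 4, MvPowerSeries.X i * ∑ j ∈ Finset.range ((i : ℕ) + 2), S ^ j with hH
  have hunit : IsUnit (1 - H) := by
    rw [MvPowerSeries.isUnit_iff_constantCoeff]
    simp [hH]
  have hmul : (S - 1) * (1 - H) = L := by
    have hfun := S_eq
    have hgeom : (S - 1) * H = ∑ i : Fin 4, (MvPowerSeries.X i : MvPowerSeries (Fin 4) ℚ) * S ^ ((i : ℕ) + 2) - L := by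
      rw [hH, Finset.mul_sum]
      simp only [mul_left_comm (S - 1), mul_geom_sum, mul_sub, mul_one, Finset.sum_sub_distrib]
      rw [hL, Fin.sum_univ_four (fun i => (MvPowerSeries.X i : MvPowerSeries (Fin 4) ℚ))]
    rw [mul_sub, mul_one, hgeom]
    linear_combination hfun
  obtain ⟨u, hu⟩ := hunit
  have hG : S - 1 = L * ↑u⁻¹ := by rw [← hmul, ← hu, Units.mul_inv_cancel_right]
  exact ⟨↑u⁻¹, hG, fun G hG' => mul_left_cancel₀ hL0 (hG'.symm.trans hG)⟩
end

section
/- For every m = (m₂,m₃,m₄,m₅) ∈ ℕ⁴ with m₂ ≥ 1, the ratio of neighboring hyper-Catalan numbers satisfies C_{(m₂−1, m₃, m₄+1, m₅)} / C_{(m₂,m₃,m₄,m₅)} = (m₂ · E_m · (E_m + 1)) / ((m₄ + 1) · V_m · (V_m + 1)); equivalently C_{(m₂−1, m₃, m₄+1, m₅)} · (m₄+1) · V_m · (V_m+1) = C_{(m₂,m₃,m₄,m₅)} · m₂ · E_m · (E_m+1). -/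
/-- Ratio of hyper-Catalan neighbors:
C_{(m₂−1,m₃,m₄+1,m₅)} / C_m = (m₂·E_m·(E_m+1)) / ((m₄+1)·V_m·(V_m+1)), for m₂ ≥ 1;
equivalently C_{(m₂−1,m₃,m₄+1,m₅)} · (m₄+1) · V_m · (V_m+1) = C_m · m₂ · E_m · (E_m+1). -/
theorem hyperCatalan_ratio_m4 (m2 m3 m4 m5 : ℕ) (h : 1 ≤ m2) :
    hyperCatalan (m2 - 1) m3 (m4 + 1) m5 * (m4 + 1 : ℚ) * (Vm m2 m3 m4 m5 : ℚ) *
        ((Vm m2 m3 m4 m5 : ℚ) + 1) =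
      hyperCatalan m2 m3 m4 m5 * (m2 : ℚ) * (Em m2 m3 m4 m5 : ℚ) *
        ((Em m2 m3 m4 m5 : ℚ) + 1) := by
  obtain ⟨a, rfl⟩ : ∃ a, m2 = a + 1 := ⟨m2 - 1, by omega⟩
  obtain ⟨e, he⟩ : ∃ e, Em (a + 1) m3 m4 m5 = e + 1 := ⟨_, (Nat.sub_add_cancel (by
    unfold Em; omega)).symm⟩
  obtain ⟨v, hv⟩ : ∃ v, Vm (a + 1) m3 m4 m5 = v + 1 := ⟨_, (Nat.sub_add_cancel (by
    unfold Vm; omega)).symm⟩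
  have he' : Em a m3 (m4 + 1) m5 = e + 3 := by unfold Em at *; omega
  have hv' : Vm a m3 (m4 + 1) m5 = v + 3 := by unfold Vm at *; omega
  simp only [hyperCatalan, Nat.add_sub_cancel, he, hv, he', hv',
    show e + 3 - 1 = e + 1 + 1 from rfl, show v + 3 - 1 = v + 1 + 1 from rfl,
    Nat.factorial_succ]
  have hvf : (v.factorial : ℚ) ≠ 0 := by positivity
  have haf : (a.factorial : ℚ) ≠ 0 := by positivity
  have h3f : (m3.factorial : ℚ) ≠ 0 := by positivity
  have h4f : (m4.factorial : ℚ) ≠ 0 := by positivity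
  have h5f : (m5.factorial : ℚ) ≠ 0 := by positivity
  push_cast
  field_simp
end
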